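/- Completeness of the conjunction-negation fragment with respect to the three-element algebra: for all Γ ∪ {φ} ⊆ 𝔉_{{∧,¬}} (formulas built from letters using only ∧ and ¬), Γ ⊢_{{∧,¬}} φ if and only if Γ ⊨_𝟑 φ, where 𝟑 is the algebra on {0, 1/2, 1} with a ∧ b = min(a,b), ¬0 = 1, ¬(1/2) = ¬1 = 0, and designated set D = {1}. -/

import Mathlib

/-- The four propositional connectives. -/
inductive Conn : Type
  | conj | disj | impl | nega
deriving DecidableEq

/-- Propositional formulas over countably many letters `p₀, p₁, …`. -/
inductive PropForm : Type
  | var : ℕ → PropForm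
  | and : PropForm → PropForm → PropForm
  | or : PropForm → PropForm → PropForm
  | imp : PropForm → PropForm → PropForm
  | neg : PropForm → PropForm

/-- The set of connectives occurring in a formula. -/
def PropForm.conns : PropForm → Set Conn
  | .var _ => ∅
  | .and a b => insert .conj (a.conns ∪ b.conns)
  | .or a b => insert .disj (a.conns ∪ b.conns)
  | .imp a b => insert .impl (a.conns ∪ b.conns)
  | .neg a => insert .nega a.conns

/-- `φ ∈ 𝔉_F` : the formula `φ` uses only connectives belonging to the fragment `F`. -/
def InFrag (F : Set Conn) (φ : PropForm) : Prop := φ.conns ⊆ F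

/-- Derivability `Γ ⊢_F φ` for the fragment `F`: the least relation closed under
membership, monotonicity, cut, and the two directions of the rules
(R∧), (R∨), (R→), (R¬I), (R¬E) for the connectives in `F`. -/
inductive Deriv (F : Set Conn) : Set PropForm → PropForm → Prop
  | mem {Γ : Set PropForm} {φ : PropForm} : φ ∈ Γ → Deriv F Γ φ
  | mono {Γ : Set PropForm} {φ ψ : PropForm} : Deriv F Γ φ → Deriv F (insert ψ Γ) φ
  | cut {Γ Δ : Set PropForm} {φ ψ : PropForm} :
      Deriv F Γ φ → Deriv F (insert φ Δ) ψ → Deriv F (Γ ∪ Δ) ψ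
  | andI {Γ : Set PropForm} {φ ψ : PropForm} :
      Conn.conj ∈ F → Deriv F Γ φ → Deriv F Γ ψ → Deriv F Γ (.and φ ψ)
  | andE1 {Γ : Set PropForm} {φ ψ : PropForm} :
      Conn.conj ∈ F → Deriv F Γ (.and φ ψ) → Deriv F Γ φ
  | andE2 {Γ : Set PropForm} {φ ψ : PropForm} :
      Conn.conj ∈ F → Deriv F Γ (.and φ ψ) → Deriv F Γ ψ
  | orI {Γ : Set PropForm} {φ ψ χ : PropForm} :
      Conn.disj ∈ F → Deriv F (insert φ Γ) χ → Deriv F (insert ψ Γ) χ →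
      Deriv F (insert (.or φ ψ) Γ) χ
  | orE1 {Γ : Set PropForm} {φ ψ χ : PropForm} :
      Conn.disj ∈ F → Deriv F (insert (.or φ ψ) Γ) χ → Deriv F (insert φ Γ) χ
  | orE2 {Γ : Set PropForm} {φ ψ χ : PropForm} :
      Conn.disj ∈ F → Deriv F (insert (.or φ ψ) Γ) χ → Deriv F (insert ψ Γ) χ
  | impI {Γ : Set PropForm} {φ ψ : PropForm} :
      Conn.impl ∈ F → Deriv F (insert φ Γ) ψ → Deriv F Γ (.imp φ ψ)
  | impE {Γ : Set PropForm} {φ ψ : PropForm} :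
      Conn.impl ∈ F → Deriv F Γ (.imp φ ψ) → Deriv F (insert φ Γ) ψ
  | negI {Γ : Set PropForm} {φ ψ : PropForm} :
      Conn.nega ∈ F → Deriv F (insert φ Γ) ψ → Deriv F (insert φ Γ) (.neg ψ) →
      Deriv F Γ (.neg φ)
  | negE {Γ : Set PropForm} {φ ψ : PropForm} :
      Conn.nega ∈ F → Deriv F Γ φ → Deriv F Γ (.neg φ) → Deriv F Γ ψ

/-- An algebra interpreting the connectives on a carrier `V`. -/
structure Alg (V : Type) where
  and : V → V → V
  or : V → V → V
  imp : V → V → V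
  neg : V → V

/-- The homomorphic extension of an assignment `v` of letters. -/
def Alg.eval {V : Type} (A : Alg V) (v : ℕ → V) : PropForm → V
  | .var n => v n
  | .and a b => A.and (A.eval v a) (A.eval v b)
  | .or a b => A.or (A.eval v a) (A.eval v b)
  | .imp a b => A.imp (A.eval v a) (A.eval v b)
  | .neg a => A.neg (A.eval v a)

/-- Semantic consequence `Γ ⊨_{A,D} φ`. -/
def SemConseq {V : Type} (A : Alg V) (D : Set V) (Γ : Set PropForm) (φ : PropForm) : Prop :=
  ∀ v : ℕ → V, (∀ ψ ∈ Γ, A.eval v ψ ∈ D) → A.eval v φ ∈ D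

/-- The fragment `F` has a finite semantics. -/
def HasFiniteSemantics (F : Set Conn) : Prop :=
  ∃ (V : Type) (_ : Fintype V) (A : Alg V) (D : Set V),
    ∀ (Γ : Set PropForm) (φ : PropForm),
      (∀ ψ ∈ Γ, InFrag F ψ) → InFrag F φ →
      (Deriv F Γ φ ↔ SemConseq A D Γ φ)

/-- `φ ∨̇ ψ = (φ → ψ) → ψ`. -/
def dvee (a b : PropForm) : PropForm := .imp (.imp a b) b

/-- Left-associated iterated `∨̇` of a list of formulas. -/
def bigDvee : List PropForm → PropForm
  | [] => .var 0
  | a :: rest => rest.foldl dvee a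

/-- Left-associated iterated `∨` of a list of formulas. -/
def bigOrF : List PropForm → PropForm
  | [] => .var 0
  | a :: rest => rest.foldl PropForm.or a

/-- All pairs `(i, j)` with `1 ≤ i < j ≤ n+1`. -/
def pairs (n : ℕ) : List (ℕ × ℕ) :=
  (List.range' 2 n).flatMap fun j => (List.range' 1 (j - 1)).map fun i => (i, j)

/-- `α_n = ∨̇_{1 ≤ i < j ≤ n+1} (p_j → p_i)`. -/
def alphaImp (n : ℕ) : PropForm :=
  bigDvee ((pairs n).map fun p => .imp (.var p.2) (.var p.1))

/-- `α_n = ⋁_{1 ≤ i < j ≤ n+1} ¬¬(¬p_i ∨ p_j)`. -/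
def alphaOrNeg (n : ℕ) : PropForm :=
  bigOrF ((pairs n).map fun p => .neg (.neg (.or (.neg (.var p.1)) (.var p.2))))

/-- Two-valued Boolean evaluation. -/
def evalBool (v : ℕ → Bool) : PropForm → Bool
  | .var n => v n
  | .and a b => evalBool v a && evalBool v b
  | .or a b => evalBool v a || evalBool v b
  | .imp a b => !evalBool v a || evalBool v b
  | .neg a => !evalBool v a

/-- Classical (two-valued) consequence `Γ ⊢_c φ`. -/
def ClassConseq (Γ : Set PropForm) (φ : PropForm) : Prop :=
  ∀ v : ℕ → Bool, (∀ ψ ∈ Γ, evalBool v ψ = true) → evalBool v φ = true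

/-- The two-element Boolean algebra `𝟐`. -/
def alg2 : Alg Bool where
  and a b := a && b
  or a b := a || b
  imp a b := !a || b
  neg a := !a

/-- The three-element algebra `𝟑` on the chain `0 < 1/2 < 1` (coded as `0 < 1 < 2` in `Fin 3`),
with meet `min` and meet complement `¬0 = 1`, `¬(1/2) = ¬1 = 0` (its `or`/`imp` are those of the
3-element Heyting chain). -/
def alg3 : Alg (Fin 3) where
  and a b := min a b
  or a b := max a b
  imp a b := if a ≤ b then 2 else b
  neg a := if a = 0 then 2 else 0

/-- The `(n+1)`-element Heyting chain, coded on `Fin (n+1)` (so `k` codes the element `k+1`). -/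
def chainAlg (n : ℕ) : Alg (Fin (n + 1)) where
  and a b := min a b
  or a b := max a b
  imp a b := if a ≤ b then Fin.last n else b
  neg a := if a = 0 then Fin.last n else 0

namespace Deriv

variable {F : Set Conn} {Γ Δ : Set PropForm} {φ ψ : PropForm}

theorem weaken (h : Deriv F Γ φ) (hΓ : Γ ⊆ Δ) : Deriv F Δ φ := by
  have := h.cut (Δ := Δ) (.mem (Set.mem_insert φ Δ))
  rwa [Set.union_eq_self_of_subset_left hΓ] at this

theorem cut_self (h : Deriv F Γ φ) (h' : Deriv F (insert φ Γ) ψ) : Deriv F Γ ψ := by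
  simpa using h.cut h'

/-- Cut against a finite set of derivable premises. -/
theorem cut_finite {s : Set PropForm} (hs : s.Finite) (hΓ : ∀ ψ ∈ s, Deriv F Γ ψ)
    (h : Deriv F s φ) : Deriv F Γ φ := by
  suffices ∀ Γ : Set PropForm, (∀ ψ ∈ s, Deriv F Γ ψ) → Deriv F (s ∪ Γ) φ → Deriv F Γ φ from
    this Γ hΓ (h.weaken Set.subset_union_left)
  clear h hΓ
  induction s, hs using Set.Finite.induction_on with
  | empty => intro Γ _ h; simpa using h
  | @insert a s _ _ ih =>
    intro Γ hΓ h
    refine (hΓ a (Set.mem_insert a s)).cut_self (ih _ ?_ ?_)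
    · exact fun ψ hψ => (hΓ ψ (Set.mem_insert_of_mem a hψ)).mono
    · rwa [Set.union_insert, ← Set.insert_union]

end Deriv

/-- Collapsing the middle element of `𝟑` to the top is an endomorphism. -/
theorem alg3_eval_collapse (v : ℕ → Fin 3) (φ : PropForm) :
    alg3.eval (fun n => if v n = 0 then 0 else 2) φ = if alg3.eval v φ = 0 then 0 else 2 := by
  have hand : ∀ a b : Fin 3, alg3.and (if a = 0 then 0 else 2) (if b = 0 then 0 else 2) =
      if alg3.and a b = 0 then 0 else 2 := by simp only [alg3]; decide
  have hor : ∀ a b : Fin 3, alg3.or (if a = 0 then 0 else 2) (if b = 0 then 0 else 2) =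
      if alg3.or a b = 0 then 0 else 2 := by simp only [alg3]; decide
  have himp : ∀ a b : Fin 3, alg3.imp (if a = 0 then 0 else 2) (if b = 0 then 0 else 2) =
      if alg3.imp a b = 0 then 0 else 2 := by simp only [alg3]; decide
  have hneg : ∀ a : Fin 3, alg3.neg (if a = 0 then 0 else 2) =
      if alg3.neg a = 0 then 0 else 2 := by simp only [alg3]; decide
  induction φ with
  | var n => rfl
  | and a b iha ihb => rw [Alg.eval, iha, ihb]; exact hand _ _
  | or a b iha ihb => rw [Alg.eval, iha, ihb]; exact hor _ _
  | imp a b iha ihb => rw [Alg.eval, iha, ihb]; exact himp _ _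
  | neg a ih => rw [Alg.eval, ih]; exact hneg _

theorem alg3_and_eq_two {a b : Fin 3} : alg3.and a b = 2 ↔ a = 2 ∧ b = 2 := by
  revert a b; simp only [alg3]; decide

theorem alg3_and_eq_zero {a b : Fin 3} : alg3.and a b = 0 ↔ a = 0 ∨ b = 0 := by
  revert a b; simp only [alg3]; decide

theorem alg3_neg_eq_two {a : Fin 3} : alg3.neg a = 2 ↔ a = 0 := by
  revert a; simp only [alg3]; decide

theorem alg3_neg_eq_zero {a : Fin 3} : alg3.neg a = 0 ↔ a ≠ 0 := by
  revert a; simp only [alg3]; decide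

/-- Soundness of the `{∧, ¬}`-rules in `𝟑`. -/
theorem Deriv.semConseq_alg3 {Γ : Set PropForm} {φ : PropForm}
    (h : Deriv {Conn.conj, Conn.nega} Γ φ) : SemConseq alg3 {2} Γ φ := by
  induction h with
  | mem h => exact fun v hv => hv _ h
  | mono _ ih => exact fun v hv => ih v fun χ hχ => hv χ (Set.mem_insert_of_mem _ hχ)
  | cut _ _ ih₁ ih₂ =>
    intro v hv
    refine ih₂ v (Set.forall_mem_insert.2 ⟨ih₁ v fun χ hχ => hv χ (.inl hχ), ?_⟩)
    exact fun χ hχ => hv χ (.inr hχ)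
  | andI _ _ _ ih₁ ih₂ => exact fun v hv => alg3_and_eq_two.2 ⟨ih₁ v hv, ih₂ v hv⟩
  | andE1 _ _ ih => exact fun v hv => (alg3_and_eq_two.1 (ih v hv)).1
  | andE2 _ _ ih => exact fun v hv => (alg3_and_eq_two.1 (ih v hv)).2
  | orI h | orE1 h | orE2 h | impI h | impE h => simp at h
  | @negI Γ φ ψ _ _ _ ih₁ ih₂ =>
    intro v hv
    refine alg3_neg_eq_two.2 (by_contra fun hφ => ?_)
    let w : ℕ → Fin 3 := fun n => if v n = 0 then 0 else 2
    have hw : ∀ χ ∈ insert φ Γ, alg3.eval w χ ∈ ({2} : Set (Fin 3)) := by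
      refine Set.forall_mem_insert.2 ⟨?_, fun χ hχ => ?_⟩
      · simp [w, alg3_eval_collapse, hφ]
      · have : alg3.eval v χ = 2 := hv χ hχ
        simp [w, alg3_eval_collapse, this]
    have h₁ : alg3.eval w ψ = 2 := ih₁ w hw
    have h₂ : alg3.eval w ψ = 0 := alg3_neg_eq_two.1 (ih₂ w hw)
    simp [h₁] at h₂
  | negE _ _ _ ih₁ ih₂ =>
    intro v hv
    have h₁ : alg3.eval v _ = 2 := ih₁ v hv
    have h₂ := alg3_neg_eq_two.1 (ih₂ v hv)
    simp [h₁] at h₂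

/-- Every finite subset of `Γ` fails to derive some formula. -/
def FinConsistent (F : Set Conn) (Γ : Set PropForm) : Prop :=
  ∀ s ⊆ Γ, s.Finite → ∃ ψ, ¬ Deriv F s ψ

/-- The set of consequences of a consistent set is finitely consistent. -/
theorem FinConsistent.setOf_deriv {F : Set Conn} {Γ : Set PropForm} {φ : PropForm}
    (h : ¬ Deriv F Γ φ) : FinConsistent F {ψ | Deriv F Γ ψ} :=
  fun _ hs hfin => ⟨φ, fun hd => h (Deriv.cut_finite hfin hs hd)⟩

theorem FinConsistent.exists_maximal {F : Set Conn} {Γ : Set PropForm} (h : FinConsistent F Γ) :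
    ∃ Δ, Γ ⊆ Δ ∧ Maximal (FinConsistent F) Δ := by
  have hfc : Order.IsOfFiniteCharacter {Δ | FinConsistent F Δ} := fun Δ =>
    ⟨fun (hΔ : FinConsistent F Δ) s hs _ t ht => hΔ t (ht.trans hs),
      fun (hΔ : ∀ s ⊆ Δ, s.Finite → FinConsistent F s) s hs hfin =>
        hΔ s hs hfin s subset_rfl hfin⟩
  exact hfc.exists_maximal h

section Maximal

variable {F : Set Conn} {Δ s : Set PropForm} {φ ψ : PropForm}

theorem Maximal.mem_of_deriv (hΔ : Maximal (FinConsistent F) Δ) (hs : s ⊆ Δ) (hfin : s.Finite)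
    (h : Deriv F s φ) : φ ∈ Δ := by
  refine hΔ.mem_of_prop_insert fun t ht htfin => ?_
  obtain ⟨χ, hχ⟩ := hΔ.prop (s ∪ (t \ {φ}))
    (Set.union_subset hs fun x hx => (ht hx.1).resolve_left hx.2) (hfin.union htfin.sdiff)
  exact ⟨χ, fun hd => hχ (h.cut (hd.weaken (by simp)))⟩

theorem Maximal.neg_mem_iff (hF : Conn.nega ∈ F) (hΔ : Maximal (FinConsistent F) Δ) :
    φ.neg ∈ Δ ↔ φ ∉ Δ := by
  refine ⟨fun h₁ h₂ => ?_, fun h => by_contra fun h' =>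
    h (hΔ.mem_of_prop_insert fun t ht htfin => ?_)⟩
  · obtain ⟨χ, hχ⟩ := hΔ.prop {φ, φ.neg} (Set.pair_subset h₂ h₁) (Set.toFinite _)
    exact hχ (.negE (φ := φ) hF (.mem (by simp)) (.mem (by simp)))
  · by_contra! hd
    have hsub : t \ {φ} ⊆ Δ := fun x hx => (ht hx.1).resolve_left hx.2
    have hd' : ∀ ψ, Deriv F (insert φ (t \ {φ})) ψ := fun ψ => (hd ψ).weaken (by simp)
    exact h' (hΔ.mem_of_deriv hsub htfin.sdiff (.negI hF (hd' φ) (hd' φ.neg)))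

theorem Maximal.and_mem_iff (hF : Conn.conj ∈ F) (hΔ : Maximal (FinConsistent F) Δ) :
    φ.and ψ ∈ Δ ↔ φ ∈ Δ ∧ ψ ∈ Δ := by
  refine ⟨fun h => ?_, fun ⟨h₁, h₂⟩ => ?_⟩
  · have hs := Set.singleton_subset_iff.2 h
    exact ⟨hΔ.mem_of_deriv hs (Set.finite_singleton _) (.andE1 hF (.mem rfl)),
      hΔ.mem_of_deriv hs (Set.finite_singleton _) (.andE2 hF (.mem rfl))⟩
  · exact hΔ.mem_of_deriv (Set.pair_subset h₁ h₂) (Set.toFinite _)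
      (.andI hF (.mem (by simp)) (.mem (by simp)))

end Maximal

open Classical in
/-- The assignment sending letters derivable from `Γ` to `1`, the remaining letters of `Δ` to
`1/2`, and all others to `0`. -/
noncomputable def canonicalAssignment (F : Set Conn) (Γ Δ : Set PropForm) (n : ℕ) : Fin 3 :=
  if Deriv F Γ (.var n) then 2 else if .var n ∈ Δ then 1 else 0

section Canonical

variable {Γ Δ : Set PropForm}

theorem canonicalAssignment_eval_eq_zero_iff
    (hΔ : Maximal (FinConsistent {Conn.conj, Conn.nega}) Δ)
    (hΓ : {ψ | Deriv {Conn.conj, Conn.nega} Γ ψ} ⊆ Δ)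
    {φ : PropForm} (hφ : InFrag {Conn.conj, Conn.nega} φ) :
    alg3.eval (canonicalAssignment {Conn.conj, Conn.nega} Γ Δ) φ = 0 ↔ φ ∉ Δ := by
  induction φ with
  | var n =>
    simp only [Alg.eval, canonicalAssignment]
    split_ifs with h₁ h₂
    · simpa using hΓ h₁
    · simpa using h₂
    · simpa using h₂
  | and a b iha ihb =>
    simp only [InFrag, PropForm.conns, Set.insert_subset_iff, Set.union_subset_iff] at hφ
    rw [Alg.eval, alg3_and_eq_zero, iha hφ.2.1, ihb hφ.2.2, hΔ.and_mem_iff (by simp), not_and_or]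
  | or | imp => simp [InFrag, PropForm.conns, Set.insert_subset_iff] at hφ
  | neg a ih =>
    simp only [InFrag, PropForm.conns, Set.insert_subset_iff] at hφ
    rw [Alg.eval, alg3_neg_eq_zero, ne_eq, ih hφ.2, hΔ.neg_mem_iff (by simp)]

/-- The canonical assignment designates every consequence of `Γ`. -/
theorem canonicalAssignment_eval_eq_two
    (hΔ : Maximal (FinConsistent {Conn.conj, Conn.nega}) Δ)
    (hΓ : {ψ | Deriv {Conn.conj, Conn.nega} Γ ψ} ⊆ Δ)
    {φ : PropForm} (hφ : InFrag {Conn.conj, Conn.nega} φ)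
    (h : Deriv {Conn.conj, Conn.nega} Γ φ) :
    alg3.eval (canonicalAssignment {Conn.conj, Conn.nega} Γ Δ) φ = 2 := by
  induction φ with
  | var n => simp [Alg.eval, canonicalAssignment, h]
  | and a b iha ihb =>
    simp only [InFrag, PropForm.conns, Set.insert_subset_iff, Set.union_subset_iff] at hφ
    exact alg3_and_eq_two.2 ⟨iha hφ.2.1 (h.andE1 (by simp)), ihb hφ.2.2 (h.andE2 (by simp))⟩
  | or | imp => simp [InFrag, PropForm.conns, Set.insert_subset_iff] at hφ
  | neg a _ =>
    simp only [InFrag, PropForm.conns, Set.insert_subset_iff] at hφ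
    rw [Alg.eval, alg3_neg_eq_two, canonicalAssignment_eval_eq_zero_iff hΔ hΓ hφ.2,
      ← hΔ.neg_mem_iff (by simp)]
    exact hΓ h

end Canonical

/-- Every underivable fragment formula is refuted in `𝟑`. -/
theorem not_semConseq_alg3_of_not_deriv {Γ : Set PropForm} {φ : PropForm}
    (hΓ : ∀ ψ ∈ Γ, InFrag {Conn.conj, Conn.nega} ψ) (hφ : InFrag {Conn.conj, Conn.nega} φ)
    (h : ¬ Deriv {Conn.conj, Conn.nega} Γ φ) : ¬ SemConseq alg3 {2} Γ φ := by
  induction φ with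
  | var n =>
    intro hsem
    obtain ⟨Δ, hΓΔ, hΔ⟩ := (FinConsistent.setOf_deriv h).exists_maximal
    have hn := hsem (canonicalAssignment {Conn.conj, Conn.nega} Γ Δ) fun ψ hψ =>
      canonicalAssignment_eval_eq_two hΔ hΓΔ (hΓ ψ hψ) (.mem hψ)
    simp only [Alg.eval, canonicalAssignment, h, if_false] at hn
    split_ifs at hn <;> simp at hn
  | and a b iha ihb =>
    simp only [InFrag, PropForm.conns, Set.insert_subset_iff, Set.union_subset_iff] at hφ
    intro hsem
    refine h (.andI (by simp) (by_contra fun ha => ?_) (by_contra fun hb => ?_))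
    · exact iha hφ.2.1 ha fun v hv => (alg3_and_eq_two.1 (hsem v hv)).1
    · exact ihb hφ.2.2 hb fun v hv => (alg3_and_eq_two.1 (hsem v hv)).2
  | or | imp => simp [InFrag, PropForm.conns, Set.insert_subset_iff] at hφ
  | neg a _ =>
    simp only [InFrag, PropForm.conns, Set.insert_subset_iff] at hφ
    intro hsem
    have hcons : ¬ Deriv {Conn.conj, Conn.nega} (insert a Γ) a.neg := fun hd =>
      h (.negI (by simp) (.mem (Set.mem_insert a Γ)) hd)
    obtain ⟨Δ, hΓΔ, hΔ⟩ := (FinConsistent.setOf_deriv hcons).exists_maximal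
    have hn := hsem (canonicalAssignment {Conn.conj, Conn.nega} (insert a Γ) Δ) fun ψ hψ =>
      canonicalAssignment_eval_eq_two hΔ hΓΔ (hΓ ψ hψ) (.mem (Set.mem_insert_of_mem a hψ))
    exact (canonicalAssignment_eval_eq_zero_iff hΔ hΓΔ hφ.2).1 (alg3_neg_eq_two.1 hn)
      (hΓΔ (.mem (Set.mem_insert a Γ)))

/-- completeness of the `{∧, ¬}`-fragment w.r.t. the three-element
algebra `𝟑` (universe `{0, 1/2, 1}` coded as `Fin 3`) with designated set `{1}`
(coded `{2}`). -/
theorem conj_neg_fragment_three_valued (Γ : Set PropForm) (φ : PropForm)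
    (hΓ : ∀ ψ ∈ Γ, InFrag {Conn.conj, Conn.nega} ψ) (hφ : InFrag {Conn.conj, Conn.nega} φ) :
    Deriv {Conn.conj, Conn.nega} Γ φ ↔ SemConseq alg3 {2} Γ φ :=
  ⟨Deriv.semConseq_alg3, fun h => by_contra fun hd => not_semConseq_alg3_of_not_deriv hΓ hφ hd h⟩
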